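/- Under the stated hypotheses on ψ₁ and Γ, there is an absolute constant c such that ∫_Ω ( (∂_r²ψ₁)² + (∂_r∂_zψ₁)² + (∂_z²ψ₁)² + (∂_rψ₁)²/r² ) + ∫_{−a}^{a} ( (∂_zψ₁(0,z))² + (∂_rψ₁(R,z))² ) dz ≤ c |Γ|²_{2,Ω}. -/

import Mathlib

open MeasureTheory Real Set ENNReal

noncomputable section

/-- Partial derivative in `r` of a function `w r z` of two variables. -/
def qdr (w : ℝ → ℝ → ℝ) : ℝ → ℝ → ℝ := fun r z => deriv (fun x => w x z) r

/-- Partial derivative in `z` of a function `w r z` of two variables. -/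
def qdz (w : ℝ → ℝ → ℝ) : ℝ → ℝ → ℝ := fun r z => deriv (fun x => w r x) z

/-- The integral `∫_Ω w` over the rectangle `(0,R) × (-a,a)` with respect to the
measure `r dr dz`. -/
def I2 (R a : ℝ) (w : ℝ → ℝ → ℝ) : ℝ :=
  ∫ q in (Ioo (0 : ℝ) R) ×ˢ (Ioo (-a) a), w q.1 q.2 * q.1

/-- The data of the elliptic problem for the modified stream function: smooth functions
`ψ₁` and `Γ` on the rectangle `[0,R] × [-a,a]` satisfying
`−∂_r²ψ₁ − (3/r)∂_rψ₁ − ∂_z²ψ₁ = Γ` in the interior (i.e. `−Δψ₁ − (2/r)∂_rψ₁ = Γ`),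
the boundary conditions `ψ₁(R,·) = 0`, `ψ₁(·,±a) = 0`, and the axis condition
`∂_rψ₁(0,·) = 0`. -/
structure StreamData (R a : ℝ) where
  psi : ℝ → ℝ → ℝ
  Gam : ℝ → ℝ → ℝ
  smooth_psi : ContDiff ℝ (⊤ : ℕ∞) (fun q : ℝ × ℝ => psi q.1 q.2)
  smooth_Gam : ContDiff ℝ (⊤ : ℕ∞) (fun q : ℝ × ℝ => Gam q.1 q.2)
  eqn : ∀ r ∈ Ioo (0 : ℝ) R, ∀ z ∈ Ioo (-a) a,
    -qdr (qdr psi) r z - (3 / r) * qdr psi r z - qdz (qdz psi) r z = Gam r z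
  bc_lat : ∀ z ∈ Icc (-a) a, psi R z = 0
  bc_horiz : ∀ r ∈ Icc (0 : ℝ) R, psi r a = 0 ∧ psi r (-a) = 0
  axis : ∀ z ∈ Icc (-a) a, qdr psi 0 z = 0


/-- Joint smoothness of a curried function. -/
def SM (w : ℝ → ℝ → ℝ) : Prop := ContDiff ℝ (⊤ : ℕ∞) (fun q : ℝ × ℝ => w q.1 q.2)

lemma SM.fd {w : ℝ → ℝ → ℝ} (h : SM w) (q : ℝ × ℝ) :
    HasFDerivAt (fun q : ℝ × ℝ => w q.1 q.2) (fderiv ℝ (fun q : ℝ × ℝ => w q.1 q.2) q) q :=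
  (h.differentiable (by simp)).differentiableAt.hasFDerivAt

lemma SM.hdr0 {w : ℝ → ℝ → ℝ} (h : SM w) (r z : ℝ) :
    HasDerivAt (fun x => w x z) (fderiv ℝ (fun q : ℝ × ℝ => w q.1 q.2) (r, z) (1, 0)) r := by
  have h2 : HasDerivAt (fun x : ℝ => (x, z)) ((1 : ℝ), (0 : ℝ)) r :=
    (hasDerivAt_id r).prodMk (hasDerivAt_const r z)
  exact (h.fd (r, z)).comp_hasDerivAt r h2

lemma SM.hdz0 {w : ℝ → ℝ → ℝ} (h : SM w) (r z : ℝ) :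
    HasDerivAt (fun x => w r x) (fderiv ℝ (fun q : ℝ × ℝ => w q.1 q.2) (r, z) (0, 1)) z := by
  have h2 : HasDerivAt (fun x : ℝ => (r, x)) ((0 : ℝ), (1 : ℝ)) z :=
    (hasDerivAt_const z r).prodMk (hasDerivAt_id z)
  exact (h.fd (r, z)).comp_hasDerivAt z h2

lemma SM.qdr_eq {w : ℝ → ℝ → ℝ} (h : SM w) (r z : ℝ) :
    qdr w r z = fderiv ℝ (fun q : ℝ × ℝ => w q.1 q.2) (r, z) (1, 0) := (h.hdr0 r z).deriv

lemma SM.qdz_eq {w : ℝ → ℝ → ℝ} (h : SM w) (r z : ℝ) :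
    qdz w r z = fderiv ℝ (fun q : ℝ × ℝ => w q.1 q.2) (r, z) (0, 1) := (h.hdz0 r z).deriv

lemma SM.hdr {w : ℝ → ℝ → ℝ} (h : SM w) (r z : ℝ) :
    HasDerivAt (fun x => w x z) (qdr w r z) r := by
  rw [h.qdr_eq]; exact h.hdr0 r z

lemma SM.hdz {w : ℝ → ℝ → ℝ} (h : SM w) (r z : ℝ) :
    HasDerivAt (fun x => w r x) (qdz w r z) z := by
  rw [h.qdz_eq]; exact h.hdz0 r z

lemma SM.fds {w : ℝ → ℝ → ℝ} (h : SM w) :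
    ContDiff ℝ (⊤ : ℕ∞) (fderiv ℝ (fun q : ℝ × ℝ => w q.1 q.2)) :=
  ContDiff.fderiv_right (m := (⊤ : ℕ∞)) h (by simp)

lemma SM.qdr {w : ℝ → ℝ → ℝ} (h : SM w) : SM (qdr w) := by
  have : (fun q : ℝ × ℝ => _root_.qdr w q.1 q.2) =
      fun q => fderiv ℝ (fun q : ℝ × ℝ => w q.1 q.2) q (1, 0) := by
    funext q; exact h.qdr_eq q.1 q.2
  unfold SM
  rw [this]
  exact h.fds.clm_apply contDiff_const

lemma SM.qdz {w : ℝ → ℝ → ℝ} (h : SM w) : SM (qdz w) := by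
  have : (fun q : ℝ × ℝ => _root_.qdz w q.1 q.2) =
      fun q => fderiv ℝ (fun q : ℝ × ℝ => w q.1 q.2) q (0, 1) := by
    funext q; exact h.qdz_eq q.1 q.2
  unfold SM
  rw [this]
  exact h.fds.clm_apply contDiff_const

lemma SM.cont {w : ℝ → ℝ → ℝ} (h : SM w) : Continuous (fun q : ℝ × ℝ => w q.1 q.2) :=
  ContDiff.continuous h

lemma SM.swap {w : ℝ → ℝ → ℝ} (h : SM w) : _root_.qdr (_root_.qdz w) = _root_.qdz (_root_.qdr w) := by
  funext r z
  have hs : IsSymmSndFDerivAt ℝ (fun q : ℝ × ℝ => w q.1 q.2) (r, z) :=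
    (ContDiff.contDiffAt h).isSymmSndFDerivAt (by simp; exact WithTop.coe_le_coe.2 le_top)
  have hF : DifferentiableAt ℝ (fderiv ℝ (fun q : ℝ × ℝ => w q.1 q.2)) (r, z) :=
    (h.fds.differentiable (by simp)).differentiableAt
  rw [h.qdz.qdr_eq, h.qdr.qdz_eq]
  have e1 : (fun q : ℝ × ℝ => _root_.qdr w q.1 q.2) =
      fun q => fderiv ℝ (fun q : ℝ × ℝ => w q.1 q.2) q (1, 0) := by
    funext q; exact h.qdr_eq q.1 q.2
  have e2 : (fun q : ℝ × ℝ => _root_.qdz w q.1 q.2) =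
      fun q => fderiv ℝ (fun q : ℝ × ℝ => w q.1 q.2) q (0, 1) := by
    funext q; exact h.qdz_eq q.1 q.2
  rw [e1, e2, fderiv_clm_apply hF (differentiableAt_const _),
    fderiv_clm_apply hF (differentiableAt_const _)]
  simpa using hs.eq (1, 0) (0, 1)

lemma cont_int {f : ℝ × ℝ → ℝ} (hf : Continuous f) (a b c d : ℝ) :
    IntegrableOn f (Ioo a b ×ˢ Ioo c d) :=
  (hf.continuousOn.integrableOn_compact (isCompact_Icc.prod isCompact_Icc)).mono_set
    (Set.prod_mono Ioo_subset_Icc_self Ioo_subset_Icc_self)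

lemma cont_int1 {f : ℝ → ℝ} (hf : Continuous f) (a b : ℝ) :
    IntegrableOn f (Ioo a b) :=
  (hf.continuousOn.integrableOn_compact isCompact_Icc).mono_set Ioo_subset_Icc_self

lemma ftcIoo {f f' : ℝ → ℝ} (hd : ∀ x, HasDerivAt f (f' x) x) (hc : Continuous f') {a b : ℝ}
    (hab : a ≤ b) : ∫ x in Ioo a b, f' x = f b - f a := by
  rw [← integral_Ioc_eq_integral_Ioo, ← intervalIntegral.integral_of_le hab]
  exact intervalIntegral.integral_eq_sub_of_hasDerivAt (fun x _ => hd x)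
    (hc.intervalIntegrable a b)

lemma int_z {F F' : ℝ → ℝ → ℝ} (hd : ∀ r z, HasDerivAt (fun x => F r x) (F' r z) z)
    (hc : Continuous (fun q : ℝ × ℝ => F' q.1 q.2)) {a b c d : ℝ} (hcd : c ≤ d) :
    ∫ q in Ioo a b ×ˢ Ioo c d, F' q.1 q.2 = ∫ r in Ioo a b, (F r d - F r c) := by
  have hi := cont_int hc a b c d
  rw [Measure.volume_eq_prod] at hi ⊢
  rw [setIntegral_prod _ hi]
  congr 1
  funext r
  exact ftcIoo (hd r) (hc.comp (by fun_prop : Continuous fun z : ℝ => (r, z))) hcd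

lemma int_r {F F' : ℝ → ℝ → ℝ} (hd : ∀ r z, HasDerivAt (fun x => F x z) (F' r z) r)
    (hc : Continuous (fun q : ℝ × ℝ => F' q.1 q.2)) {a b c d : ℝ} (hab : a ≤ b) :
    ∫ q in Ioo a b ×ˢ Ioo c d, F' q.1 q.2 = ∫ z in Ioo c d, (F b z - F a z) := by
  have hi := cont_int hc a b c d
  rw [Measure.volume_eq_prod] at hi ⊢
  rw [← setIntegral_prod_swap, setIntegral_prod]
  · congr 1
    funext z
    exact ftcIoo (fun r => hd r z) (hc.comp (by fun_prop : Continuous fun r : ℝ => (r, z))) hab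
  · exact hi.swap

lemma lin_int {μ : Measure (ℝ × ℝ)} {f1 f2 f3 f4 : ℝ × ℝ → ℝ} (i1 : Integrable f1 μ)
    (i2 : Integrable f2 μ) (i3 : Integrable f3 μ) (i4 : Integrable f4 μ) :
    ∫ q, (f4 q + 6 * (f1 q - f2 q) + 3 * f3 q) ∂μ =
      (∫ q, f4 q ∂μ) + 6 * ((∫ q, f1 q ∂μ) - ∫ q, f2 q ∂μ) + 3 * ∫ q, f3 q ∂μ := by
  have h12 : Integrable (fun q => 6 * (f1 q - f2 q)) μ := (i1.sub i2).const_mul 6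
  have h3 : Integrable (fun q => 3 * f3 q) μ := i3.const_mul 3
  have h4 : Integrable (fun q => f4 q + 6 * (f1 q - f2 q)) μ := i4.add h12
  rw [integral_add h4 h3, integral_add i4 h12, integral_const_mul, integral_const_mul,
    integral_sub i1 i2]

lemma qdr_zero {w : ℝ → ℝ → ℝ} {R z : ℝ} (h : ∀ r ∈ Ioo (0 : ℝ) R, w r z = 0) :
    ∀ r ∈ Ioo (0 : ℝ) R, qdr w r z = 0 := by
  intro r hr
  have : (fun x => w x z) =ᶠ[nhds r] fun _ => 0 := by
    filter_upwards [isOpen_Ioo.mem_nhds hr] with x hx using h x hx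
  unfold qdr
  rw [this.deriv_eq]; simp

lemma qdz_zero {w : ℝ → ℝ → ℝ} {r a : ℝ} (h : ∀ z ∈ Ioo (-a) a, w r z = 0) :
    ∀ z ∈ Ioo (-a) a, qdz w r z = 0 := by
  intro z hz
  have : (fun x => w r x) =ᶠ[nhds z] fun _ => 0 := by
    filter_upwards [isOpen_Ioo.mem_nhds hz] with x hx using h x hx
  unfold qdz
  rw [this.deriv_eq]; simp

/-- `H²` elliptic estimate for `ψ₁`:
`∫_Ω ((∂_r²ψ₁)² + (∂_r∂_zψ₁)² + (∂_z²ψ₁)² + (∂_rψ₁)²/r²)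
  + ∫_{−a}^{a} ((∂_zψ₁(0,z))² + (∂_rψ₁(R,z))²) dz ≤ c |Γ|²_{2,Ω}`
for an absolute constant `c`. -/
theorem statement9 :
    ∃ c : ℝ,
      ∀ (R a : ℝ), 0 < R → 0 < a → ∀ S : StreamData R a,
        I2 R a (fun r z =>
            (qdr (qdr S.psi) r z) ^ 2 + (qdr (qdz S.psi) r z) ^ 2 +
              (qdz (qdz S.psi) r z) ^ 2 + (qdr S.psi r z) ^ 2 / r ^ 2) +
          (∫ z in Set.Ioo (-a) a, ((qdz S.psi 0 z) ^ 2 + (qdr S.psi R z) ^ 2)) ≤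
        c * I2 R a (fun r z => (S.Gam r z) ^ 2) := by
  refine ⟨5, fun R a hR ha S => ?_⟩
  have hp : SM S.psi := S.smooth_psi
  have hG : SM S.Gam := S.smooth_Gam
  have hR' := hR.le
  have ha' : -a ≤ a := by linarith
  have eqn := S.eqn
  have axis := S.axis
  have sw : qdr (qdr (qdz S.psi)) = qdz (qdr (qdr S.psi)) := by
    rw [hp.swap, hp.qdr.swap]
  have b0 : ∀ r ∈ Ioo (0 : ℝ) R, S.psi r a = 0 := fun r hr =>
    (S.bc_horiz r (Ioo_subset_Icc_self hr)).1
  have b1 : ∀ r ∈ Ioo (0 : ℝ) R, S.psi r (-a) = 0 := fun r hr =>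
    (S.bc_horiz r (Ioo_subset_Icc_self hr)).2
  have b2 := qdz_zero (fun z hz => S.bc_lat z (Ioo_subset_Icc_self hz))
  have P0 := qdr_zero b0
  have P1 := qdr_zero b1
  have A0 := qdr_zero P0
  have A1 := qdr_zero P1
  have hP := hp.qdr
  have hQ := hp.qdz
  have hA := hP.qdr
  have hB := hQ.qdr
  have hC := hQ.qdz
  have hAz := hA.qdz
  have hBeq : qdz (qdr S.psi) = qdr (qdz S.psi) := hp.swap.symm
  have dPr := hP.hdr
  have dPz := hP.hdz
  have dQr := hQ.hdr
  have dQz := hQ.hdz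
  have dAz := hA.hdz
  have dBr := hB.hdr
  rw [sw] at dBr
  rw [hBeq] at dPz
  unfold I2
  generalize S.psi = psi at *
  generalize S.Gam = G at *
  generalize qdz (qdr (qdr psi)) = Az at *
  generalize qdr (qdr psi) = A at *
  generalize qdr (qdz psi) = B at *
  generalize qdz (qdz psi) = C at *
  generalize qdr psi = P at *
  generalize qdz psi = Q at *
  have cG := hG.cont
  have cA := hA.cont
  have cB := hB.cont
  have cC := hC.cont
  have cP := hP.cont
  have cQ := hQ.cont
  have cAz := hAz.cont
  have cQ0 : Continuous (fun z => Q 0 z) :=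
    cQ.comp (by fun_prop : Continuous fun z : ℝ => ((0 : ℝ), z))
  have cPR : Continuous (fun z => P R z) :=
    cP.comp (by fun_prop : Continuous fun z : ℝ => (R, z))
  have I1 := int_z (F := fun r z => (r * A r z + 3 * P r z) * Q r z)
    (F' := fun r z => (r * Az r z + 3 * B r z) * Q r z + (r * A r z + 3 * P r z) * C r z)
    (fun r z => (((dAz r z).const_mul r).add ((dPz r z).const_mul 3)).mul (dQz r z))
    (by fun_prop) (a := 0) (b := R) ha'
  have I2' := int_r (F := fun r z => r * B r z * Q r z + Q r z ^ 2)
    (F' := fun r z => r * Az r z * Q r z + r * B r z ^ 2 + 3 * (B r z * Q r z))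
    (fun r z => by
      have := ((((hasDerivAt_id r).mul (dBr r z)).mul (dQr r z))).add ((dQr r z).pow 2)
      refine this.congr_deriv ?_
      simp; ring)
    (by fun_prop) (c := -a) (d := a) hR'
  have I3 := int_r (F := fun r z => P r z ^ 2)
    (F' := fun r z => 2 * (A r z * P r z))
    (fun r z => by
      refine ((dPr r z).pow 2).congr_deriv ?_
      simp; ring)
    (by fun_prop) (c := -a) (d := a) hR'
  have J1 : ∫ r in Ioo 0 R, ((r * A r a + 3 * P r a) * Q r a -
      (r * A r (-a) + 3 * P r (-a)) * Q r (-a)) = 0 := by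
    rw [setIntegral_congr_fun (g := fun _ => (0 : ℝ)) measurableSet_Ioo]
    · simp
    · intro r hr
      simp only [A0 r hr, A1 r hr, P0 r hr, P1 r hr]; ring
  have J2 : ∫ z in Ioo (-a) a, ((R * B R z * Q R z + Q R z ^ 2) -
      (0 * B 0 z * Q 0 z + Q 0 z ^ 2)) = - ∫ z in Ioo (-a) a, Q 0 z ^ 2 := by
    rw [← integral_neg]
    refine setIntegral_congr_fun measurableSet_Ioo ?_
    intro z hz
    simp only [b2 z hz]; ring
  have J3 : ∫ z in Ioo (-a) a, (P R z ^ 2 - P 0 z ^ 2) = ∫ z in Ioo (-a) a, P R z ^ 2 := by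
    refine setIntegral_congr_fun measurableSet_Ioo ?_
    intro z hz
    simp only [axis z (Ioo_subset_Icc_self hz)]; ring
  rw [J1] at I1
  rw [J2] at I2'
  rw [J3] at I3
  have K : ∫ z in Ioo (-a) a, (Q 0 z ^ 2 + P R z ^ 2) =
      (∫ z in Ioo (-a) a, Q 0 z ^ 2) + ∫ z in Ioo (-a) a, P R z ^ 2 :=
    integral_add (cont_int1 (by fun_prop) _ _) (cont_int1 (by fun_prop) _ _)
  have pos1 : 0 ≤ ∫ z in Ioo (-a) a, Q 0 z ^ 2 := integral_nonneg fun z => by positivity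
  have pos2 : 0 ≤ ∫ z in Ioo (-a) a, P R z ^ 2 := integral_nonneg fun z => by positivity
  have hms : MeasurableSet (Ioo 0 R ×ˢ Ioo (-a) a) := measurableSet_Ioo.prod measurableSet_Ioo
  have key : ∀ r ∈ Ioo (0 : ℝ) R, ∀ z ∈ Ioo (-a) a,
      P r z = r * (-(G r z + A r z + C r z) / 3) := by
    intro r hr z hz
    have h := eqn r hr z hz
    have hr0 : r ≠ 0 := hr.1.ne'
    rw [← h]; field_simp; ring
  have L : ∫ q in Ioo 0 R ×ˢ Ioo (-a) a, (A q.1 q.2 ^ 2 + B q.1 q.2 ^ 2 + C q.1 q.2 ^ 2 +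
        P q.1 q.2 ^ 2 / q.1 ^ 2) * q.1 =
      ∫ q in Ioo 0 R ×ˢ Ioo (-a) a, (A q.1 q.2 ^ 2 + B q.1 q.2 ^ 2 + C q.1 q.2 ^ 2 +
        (-(G q.1 q.2 + A q.1 q.2 + C q.1 q.2) / 3) ^ 2) * q.1 := by
    refine setIntegral_congr_fun hms ?_
    rintro ⟨r, z⟩ ⟨hr, hz⟩
    have hr0 : r ≠ 0 := ne_of_gt hr.1
    simp only
    rw [key r hr z hz, mul_pow, mul_div_cancel_left₀ _ (pow_ne_zero 2 hr0)]
  rw [L, K]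
  -- weighted sum of identities: `5 G² r ≥ LHS integrand + combination of derivatives`
  set f1 : ℝ × ℝ → ℝ := fun q => (q.1 * Az q.1 q.2 + 3 * B q.1 q.2) * Q q.1 q.2 +
    (q.1 * A q.1 q.2 + 3 * P q.1 q.2) * C q.1 q.2 with hf1
  set f2 : ℝ × ℝ → ℝ := fun q => q.1 * Az q.1 q.2 * Q q.1 q.2 + q.1 * B q.1 q.2 ^ 2 +
    3 * (B q.1 q.2 * Q q.1 q.2) with hf2
  set f3 : ℝ × ℝ → ℝ := fun q => 2 * (A q.1 q.2 * P q.1 q.2) with hf3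
  set f4 : ℝ × ℝ → ℝ := fun q => (A q.1 q.2 ^ 2 + B q.1 q.2 ^ 2 + C q.1 q.2 ^ 2 +
        (-(G q.1 q.2 + A q.1 q.2 + C q.1 q.2) / 3) ^ 2) * q.1 with hf4
  set f5 : ℝ × ℝ → ℝ := fun q => G q.1 q.2 ^ 2 * q.1 with hf5
  have i1 : IntegrableOn f1 (Ioo 0 R ×ˢ Ioo (-a) a) := cont_int (by fun_prop) _ _ _ _
  have i2 : IntegrableOn f2 (Ioo 0 R ×ˢ Ioo (-a) a) := cont_int (by fun_prop) _ _ _ _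
  have i3 : IntegrableOn f3 (Ioo 0 R ×ˢ Ioo (-a) a) := cont_int (by fun_prop) _ _ _ _
  have i4 : IntegrableOn f4 (Ioo 0 R ×ˢ Ioo (-a) a) := cont_int (by fun_prop) _ _ _ _
  have i5 : IntegrableOn f5 (Ioo 0 R ×ˢ Ioo (-a) a) := cont_int (by fun_prop) _ _ _ _
  have M : ∫ q in Ioo 0 R ×ˢ Ioo (-a) a, (f4 q + 6 * (f1 q - f2 q) + 3 * f3 q) ≤
      ∫ q in Ioo 0 R ×ˢ Ioo (-a) a, 5 * f5 q := by
    refine setIntegral_mono_on ((i4.add ((i1.sub i2).const_mul 6)).add (i3.const_mul 3))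
      (i5.const_mul 5) hms ?_
    rintro ⟨r, z⟩ ⟨hr, hz⟩
    have hr0 : 0 < r := hr.1
    simp only [hf1, hf2, hf3, hf4, hf5]
    rw [key r hr z hz]
    generalize A r z = A
    generalize B r z = B
    generalize C r z = C
    generalize G r z = G
    generalize Az r z = Az
    generalize Q r z = Q
    have : 0 ≤ r * (5 * B ^ 2 + (G - C) ^ 2 + 3 * (C + G) ^ 2) := by positivity
    have : 0 ≤ r * (G + A + C) ^ 2 := by positivity
    nlinarith
  have M1 : ∫ q in Ioo 0 R ×ˢ Ioo (-a) a, (f4 q + 6 * (f1 q - f2 q) + 3 * f3 q) =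
      (∫ q in Ioo 0 R ×ˢ Ioo (-a) a, f4 q) + 6 * ((∫ q in Ioo 0 R ×ˢ Ioo (-a) a, f1 q) -
        ∫ q in Ioo 0 R ×ˢ Ioo (-a) a, f2 q) + 3 * ∫ q in Ioo 0 R ×ˢ Ioo (-a) a, f3 q :=
    lin_int i1 i2 i3 i4
  have M2 := integral_const_mul (μ := volume.restrict (Ioo 0 R ×ˢ Ioo (-a) a)) 5 f5
  rw [M1, M2, I1, I2', I3] at M
  linarith
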